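/- Crossley's Theorem 1.1, second case: Let p be an odd prime and let m = ((i+1)p + j + 1)p^s − 2 where 0 ≤ i ≤ p−1, 0 ≤ j ≤ p−1, and s ≥ 0. Then the images of the monomials in the set { x^{(k+1)p^s − 1} y^{m − (k+1)p^s + 1} : min(i+1, j) ≤ k ≤ p−1 } ∪ { x^{(k+1)p^{s+1} − 1} y^{m − (k+1)p^{s+1} + 1} : 0 ≤ k ≤ i } form an 𝔽_p-basis of the quotient vector space V_m / (V_m ∩ H), where V_m ⊆ P_2 = 𝔽_p[x,y] is the subspace of homogeneous polynomials of total degree m and H ⊆ P_2 is the subspace of hit polynomials. -/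

import Mathlib

open MvPolynomial

/-- The total Steenrod power map `Φ : P_h → P_h[ξ]`, the `𝔽_p`-algebra homomorphism
sending each generator `t_i` to `t_i + t_i^p ξ`. -/
noncomputable def Phi (p h : ℕ) :
    MvPolynomial (Fin h) (ZMod p) →ₐ[ZMod p] Polynomial (MvPolynomial (Fin h) (ZMod p)) :=
  aeval fun i => Polynomial.C (X i) + Polynomial.C (X i ^ p) * Polynomial.X

/-- The Steenrod power operation `𝒫^k : P_h → P_h`: the coefficient of `ξ^k` in `Φ(f)`. -/
noncomputable def steenrodP (p h : ℕ) (k : ℕ) (f : MvPolynomial (Fin h) (ZMod p)) :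
    MvPolynomial (Fin h) (ZMod p) :=
  (Phi p h f).coeff k

/-- The `𝔽_p`-subspace of hit polynomials: the span of `{𝒫^k g : k ≥ 1, g ∈ P_h}`. -/
noncomputable def Hit (p h : ℕ) : Submodule (ZMod p) (MvPolynomial (Fin h) (ZMod p)) :=
  Submodule.span (ZMod p) {g | ∃ k, 1 ≤ k ∧ ∃ u, g = steenrodP p h k u}

/-- Crossley's monomial set for degree `m = ((i+1)p + j + 1)p^s - 2`:
`{x^{(k+1)p^s-1} y^{m-(k+1)p^s+1} : min(i+1,j) ≤ k ≤ p-1}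
  ∪ {x^{(k+1)p^{s+1}-1} y^{m-(k+1)p^{s+1}+1} : 0 ≤ k ≤ i}`. -/
noncomputable def basisSet9 (p i j s m : ℕ) : Set (MvPolynomial (Fin 2) (ZMod p)) :=
  {g | ∃ k, min (i + 1) j ≤ k ∧ k ≤ p - 1 ∧
      g = X 0 ^ ((k + 1) * p ^ s - 1) * X 1 ^ (m - ((k + 1) * p ^ s - 1))} ∪
  {g | ∃ k, k ≤ i ∧
      g = X 0 ^ ((k + 1) * p ^ (s + 1) - 1) * X 1 ^ (m - ((k + 1) * p ^ (s + 1) - 1))}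

/-- The pairing of a weight `w` (a functional on degree-`m` monomials) with `𝒫^k (x^a y^b)`. -/
def SS (p : ℕ) (w : ℕ → ZMod p) (k a b : ℕ) : ZMod p :=
  ∑ q ∈ Finset.HasAntidiagonal.antidiagonal k,
    (Nat.choose a q.1 : ZMod p) * (Nat.choose b q.2 : ZMod p) * w (a + q.1 * (p - 1))

/-- The weight `w` vanishes on all hit polynomials of degree `m`. -/
def Kills (p : ℕ) (w : ℕ → ZMod p) (m : ℕ) : Prop :=
  ∀ k a b, 1 ≤ k → a + b + k * (p - 1) = m → SS p w k a b = 0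

/-- Exponents of `x` in the basis. -/
def Bex (p i j s : ℕ) : Set ℕ :=
  {A | (∃ k, min (i + 1) j ≤ k ∧ k ≤ p - 1 ∧ A = (k + 1) * p ^ s - 1) ∨
    (∃ k, k ≤ i ∧ A = (k + 1) * p ^ (s + 1) - 1)}

lemma SS_one (p : ℕ) (w : ℕ → ZMod p) (a b : ℕ) :
    SS p w 1 a b = (a : ZMod p) * w (a + (p - 1)) + (b : ZMod p) * w a := by
  simp [SS, Finset.Nat.antidiagonal_succ]
  ring

lemma choose_step (p a u : ℕ) (hp : 1 ≤ p) :
    ((u + 1 : ℕ) : ZMod p) * (Nat.choose a (u + 1) : ZMod p)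
      = (Nat.choose a u : ZMod p) * ((a + u * (p - 1) : ℕ) : ZMod p) := by
  have h := Nat.choose_succ_right_eq a u
  rcases le_or_gt u a with hu | hu
  · have h2 : (Nat.choose a (u + 1) : ZMod p) * ((u + 1 : ℕ) : ZMod p)
        = (Nat.choose a u : ZMod p) * ((a - u : ℕ) : ZMod p) := by exact_mod_cast congrArg _ h
    rw [mul_comm, h2]
    push_cast [Nat.cast_sub hu, Nat.cast_sub hp]
    simp
    ring
  · rw [Nat.choose_eq_zero_of_lt hu, Nat.choose_eq_zero_of_lt (by omega)]
    simp

lemma SS_succ (p : ℕ) (hp : 1 ≤ p) (w : ℕ → ZMod p) (k a b : ℕ) :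
    ((k + 1 : ℕ) : ZMod p) * SS p w (k + 1) a b =
      ∑ q ∈ Finset.HasAntidiagonal.antidiagonal k, (Nat.choose a q.1 : ZMod p) * (Nat.choose b q.2 : ZMod p) *
        SS p w 1 (a + q.1 * (p - 1)) (b + q.2 * (p - 1)) := by
  have h1 : ((k + 1 : ℕ) : ZMod p) * SS p w (k + 1) a b =
      (∑ q ∈ Finset.HasAntidiagonal.antidiagonal (k + 1), (((q.1 : ℕ) : ZMod p) * (Nat.choose a q.1 : ZMod p)) *
        (Nat.choose b q.2 : ZMod p) * w (a + q.1 * (p - 1))) +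
      (∑ q ∈ Finset.HasAntidiagonal.antidiagonal (k + 1), (Nat.choose a q.1 : ZMod p) *
        (((q.2 : ℕ) : ZMod p) * (Nat.choose b q.2 : ZMod p)) * w (a + q.1 * (p - 1))) := by
    rw [SS, Finset.mul_sum, ← Finset.sum_add_distrib]
    apply Finset.sum_congr rfl
    intro q hq
    rw [Finset.HasAntidiagonal.mem_antidiagonal] at hq
    rw [← hq]
    push_cast
    ring
  rw [h1, Finset.Nat.sum_antidiagonal_succ, Finset.Nat.sum_antidiagonal_succ']
  simp only [choose_step p _ _ hp, SS_one]
  simp only [Nat.cast_zero, zero_mul, mul_zero, zero_add]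
  rw [← Finset.sum_add_distrib]
  apply Finset.sum_congr rfl
  intro q hq
  have : a + (q.1 + 1) * (p - 1) = a + q.1 * (p - 1) + (p - 1) := by ring
  rw [this]
  ring

lemma kills_of (p : ℕ) [Fact p.Prime] (w : ℕ → ZMod p) (m : ℕ)
    (h1 : ∀ a b, a + b + (p - 1) = m → (a : ZMod p) * w (a + (p - 1)) + (b : ZMod p) * w a = 0)
    (h2 : ∀ k a b, 1 ≤ k → p ∣ k → a + b + k * (p - 1) = m → SS p w k a b = 0) :
    Kills p w m := by
  intro k a b hk hm
  by_cases hd : p ∣ k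
  · exact h2 k a b hk hd hm
  · obtain ⟨k, rfl⟩ : ∃ l, k = l + 1 := ⟨k - 1, by omega⟩
    have hne : ((k + 1 : ℕ) : ZMod p) ≠ 0 := by
      rw [Ne, ZMod.natCast_eq_zero_iff]; exact hd
    have := SS_succ p (Fact.out : p.Prime).one_le w k a b
    rw [Finset.sum_eq_zero] at this
    · exact (mul_eq_zero.mp this).resolve_left hne
    · intro q hq
      rw [Finset.HasAntidiagonal.mem_antidiagonal] at hq
      rw [SS_one, h1, mul_zero]
      rw [← hm, ← hq]
      ring

/-- The reindexing lemma (Kameko map). -/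
lemma SS_kameko (p : ℕ) [Fact p.Prime] (w w' : ℕ → ZMod p) (m k a b : ℕ)
    (h0 : ∀ A, A ≤ p * m + (2 * p - 2) → A % p ≠ p - 1 → w' A = 0)
    (h1 : ∀ A, w' (p * A + (p - 1)) = w A)
    (hm : a + b + k * (p - 1) = m) :
    SS p w' (p * k) (p * a + (p - 1)) (p * b + (p - 1)) = SS p w k a b := by
  have hp : p.Prime := Fact.out
  have hp2 := hp.two_le
  have luc : ∀ x y : ℕ, (Nat.choose (p * x + (p - 1)) (p * y) : ZMod p) = Nat.choose x y := by
    intro x y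
    have := Choose.choose_modEq_choose_mod_mul_choose_div_nat (n := p * x + (p - 1)) (k := p * y)
      (p := p)
    rw [← ZMod.natCast_eq_natCast_iff] at this
    rw [this]
    have e1 : (p * x + (p - 1)) / p = x := by
      rw [Nat.mul_add_div (by omega), Nat.div_eq_of_lt (by omega), add_zero]
    rw [e1, Nat.mul_mod_right, Nat.mul_div_cancel_left _ (by omega)]
    simp
  unfold SS
  rw [Finset.Nat.sum_antidiagonal_eq_sum_range_succ_mk,
    Finset.Nat.sum_antidiagonal_eq_sum_range_succ_mk]
  symm
  have himg : (Finset.range k.succ).image (fun u => p * u) ⊆ Finset.range (p * k).succ := by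
    intro x hx
    simp only [Finset.mem_image, Finset.mem_range] at hx ⊢
    obtain ⟨u, hu, rfl⟩ := hx
    have : p * u ≤ p * k := Nat.mul_le_mul_left p (by omega)
    omega
  rw [← Finset.sum_subset himg, Finset.sum_image]
  · apply Finset.sum_congr rfl
    intro u hu
    rw [Finset.mem_range] at hu
    simp only
    rw [← Nat.mul_sub, luc, luc]
    have : p * a + (p - 1) + p * u * (p - 1) = p * (a + u * (p - 1)) + (p - 1) := by ring
    rw [this, h1]
  · intro x _ y _ hxy
    exact Nat.eq_of_mul_eq_mul_left (by omega) hxy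
  · intro u hu hu2
    simp only
    rw [h0, mul_zero]
    · rw [Finset.mem_range] at hu
      have hu' : u * (p - 1) ≤ p * k * (p - 1) := Nat.mul_le_mul_right _ (by omega)
      have : p * m = p * a + p * b + p * k * (p - 1) := by rw [← hm]; ring
      omega
    · intro hmod
      apply hu2
      have h3 : ((p * a + (p - 1) + u * (p - 1) : ℕ) : ZMod p) = ((p - 1 : ℕ) : ZMod p) := by
        rw [ZMod.natCast_eq_natCast_iff]
        unfold Nat.ModEq
        rw [hmod, Nat.mod_eq_of_lt (by omega)]
      push_cast [Nat.cast_sub hp.one_le] at h3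
      simp at h3
      rw [ZMod.natCast_eq_zero_iff] at h3
      obtain ⟨v, rfl⟩ := h3
      simp only [Finset.mem_image, Finset.mem_range]
      rw [Finset.mem_range] at hu
      refine ⟨v, ?_, rfl⟩
      by_contra hc
      have : p * (k + 1) ≤ p * v := Nat.mul_le_mul_left p (by omega)
      rw [Nat.mul_add] at this
      omega

lemma cast_pm (p : ℕ) (hp : 1 ≤ p) : ((p - 1 : ℕ) : ZMod p) = -1 := by
  push_cast [Nat.cast_sub hp]; simp

/-- Downward propagation of vanishing. -/
lemma down_zero (p : ℕ) [Fact p.Prime] (w : ℕ → ZMod p) (c N : ℕ) (hc : c ≤ p - 1)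
    (hR : ∀ A, A ≤ N → (A : ZMod p) * w (A + (p - 1)) + ((c : ZMod p) - A) * w A = 0) :
    ∀ u A : ℕ, (A : ZMod p) = u → u < c → A + u * (p - 1) ≤ N → w A = 0 := by
  have hp : p.Prime := Fact.out
  have hp2 := hp.two_le
  intro u
  induction u with
  | zero =>
    intro A hA hu hN
    have h := hR A (by omega)
    rw [hA] at h
    simp at h
    rcases h with h | h
    · rw [ZMod.natCast_eq_zero_iff] at h
      have := Nat.le_of_dvd hu h
      omega
    · exact h
  | succ u ih =>
    intro A hA hu hN
    have e : A + (p - 1) + u * (p - 1) = A + (u + 1) * (p - 1) := by ring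
    have h := hR A (by omega)
    rw [ih (A + (p - 1)) _ (by omega) (by omega), mul_zero, zero_add, hA] at h
    · rw [← Nat.cast_sub (by omega)] at h
      rcases mul_eq_zero.mp h with h | h
      · rw [ZMod.natCast_eq_zero_iff] at h
        have := Nat.le_of_dvd (by omega) h
        omega
      · exact h
    · rw [Nat.cast_add, hA, cast_pm p (by omega)]
      push_cast; ring

lemma mod_cast_eq (p A d : ℕ) (hd : d < p) : A % p = d ↔ (A : ZMod p) = d := by
  rw [ZMod.natCast_eq_natCast_iff]
  unfold Nat.ModEq
  rw [Nat.mod_eq_of_lt hd]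

lemma relation_of_kills (p : ℕ) [Fact p.Prime] (w : ℕ → ZMod p) (m N c t : ℕ)
    (hk : Kills p w m) (hN : m = N + (p - 1)) (hNc : N = p * t + c) :
    ∀ A, A ≤ N → (A : ZMod p) * w (A + (p - 1)) + ((c : ZMod p) - A) * w A = 0 := by
  intro A hA
  have h := hk 1 A (N - A) le_rfl (by omega)
  rw [SS_one, Nat.cast_sub hA, hNc] at h
  push_cast at h
  simpa using h

/-- Spanning, inductive step, first half. -/
lemma zero_off (p : ℕ) [Fact p.Prime] (w : ℕ → ZMod p) (M : ℕ) (hM : p - 1 ≤ M)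
    (hk : Kills p w (p * M + (2 * p - 2))) (A : ℕ) (hA : A ≤ p * M + (2 * p - 2))
    (hmod : A % p ≠ p - 1) : w A = 0 := by
  have hp : p.Prime := Fact.out
  have hp2 := hp.two_le
  have hR := relation_of_kills p w _ (p * M + (p - 1)) (p - 1) M hk (by omega) rfl
  have hlt := Nat.mod_lt A (show p > 0 by omega)
  have hAc : (A : ZMod p) = ((A % p : ℕ) : ZMod p) := (mod_cast_eq p A _ hlt).mp rfl
  by_cases hb : (p - 1 - A % p) * (p - 1) ≤ A
  · -- forward
    have F : ∀ A1 : ℕ, (A1 : ZMod p) = -1 → ∀ u, u + 1 ≤ p - 1 →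
        A1 + (u + 1) * (p - 1) ≤ p * M + (2 * p - 2) → w (A1 + (u + 1) * (p - 1)) = 0 := by
      intro A1 hA1 u
      induction u with
      | zero =>
        intro _ hle
        have h := hR A1 (by omega)
        rw [hA1, cast_pm p (by omega)] at h
        simpa using h
      | succ u ih =>
        intro hu hle
        have e : A1 + (u + 1) * (p - 1) + (p - 1) = A1 + (u + 1 + 1) * (p - 1) := by ring
        have h := hR (A1 + (u + 1) * (p - 1)) (by omega)
        rw [ih (by omega) (by omega), mul_zero, add_zero, e] at h
        refine (mul_eq_zero.mp h).resolve_left ?_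
        rw [Nat.cast_add, Nat.cast_mul, hA1, cast_pm p (by omega)]
        have : (-1 : ZMod p) + ((u + 1 : ℕ) : ZMod p) * -1 = - ((u + 2 : ℕ) : ZMod p) := by
          push_cast; ring
        rw [this, neg_eq_zero, ZMod.natCast_eq_zero_iff]
        intro hd
        have := Nat.le_of_dvd (by omega) hd
        omega
    have h := F (A - (p - 1 - A % p) * (p - 1)) ?_ (p - 1 - A % p - 1) (by omega) ?_
    · rw [show p - 1 - A % p - 1 + 1 = p - 1 - A % p by omega, Nat.sub_add_cancel hb] at h
      exact h
    · rw [Nat.cast_sub hb, Nat.cast_mul, Nat.cast_sub (by omega), cast_pm p (by omega), hAc]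
      simp
    · rw [show p - 1 - A % p - 1 + 1 = p - 1 - A % p by omega, Nat.sub_add_cancel hb]
      exact hA
  · refine down_zero p w (p - 1) _ le_rfl hR (A % p) A hAc (by omega) ?_
    have h3 : (p - 1 - A % p) * (p - 1) + A % p * (p - 1) = (p - 1) * (p - 1) := by
      rw [← Nat.add_mul]; congr 1; omega
    have h4 : (p - 1) * (p - 1) ≤ p * M := Nat.mul_le_mul (by omega) hM
    omega

/-- Spanning, base case. -/
lemma span_base (p : ℕ) [Fact p.Prime] (i j : ℕ) (hi : i ≤ p - 1) (hj : j ≤ p - 1)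
    (w : ℕ → ZMod p) (hk : Kills p w ((i + 1) * p + j + 1 - 2))
    (hB : ∀ A ∈ Bex p i j 0, w A = 0) : ∀ A, A ≤ (i + 1) * p + j + 1 - 2 → w A = 0 := by
  have hp : p.Prime := Fact.out
  have hp2 := hp.two_le
  have em : (i + 1) * p + j + 1 - 2 = p * i + j + (p - 1) := by
    rw [add_mul, one_mul, mul_comm i p]; omega
  rw [em] at hk ⊢
  have hR := relation_of_kills p w _ (p * i + j) j i hk rfl rfl
  have small : ∀ A, A ≤ p - 1 → w A = 0 := by
    intro A hA
    by_cases hmin : min (i + 1) j ≤ A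
    · exact hB A (Or.inl ⟨A, hmin, hA, by simp⟩)
    · have h1 : A < i + 1 ∧ A < j := by omega
      refine down_zero p w j _ hj hR A A rfl h1.2 ?_
      have h2 : A + A * (p - 1) = p * A := by
        obtain ⟨q, rfl⟩ : ∃ q, p = q + 1 := ⟨p - 1, by omega⟩
        simp; ring
      have : p * A ≤ p * i := Nat.mul_le_mul_left _ (by omega)
      omega
  intro A
  induction A using Nat.strong_induction_on with
  | _ A ih =>
    intro hA
    by_cases hs : A ≤ p - 1
    · exact small A hs
    · obtain ⟨A', rfl⟩ : ∃ A', A = A' + (p - 1) := ⟨A - (p - 1), by omega⟩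
      have h := hR A' (by omega)
      rw [ih A' (by omega) (by omega), mul_zero, add_zero] at h
      rcases mul_eq_zero.mp h with h | h
      · rw [ZMod.natCast_eq_zero_iff] at h
        obtain ⟨t, rfl⟩ := h
        apply hB
        right
        refine ⟨t, ?_, ?_⟩
        · by_contra hc
          have : p * (i + 1) ≤ p * t := Nat.mul_le_mul_left _ (by omega)
          rw [Nat.mul_add] at this
          omega
        · simp only [zero_add, pow_one]
          rw [add_mul, mul_comm t p]
          omega
      · exact h

lemma Bex_succ (p i j s : ℕ) (hp : 1 ≤ p) (A : ℕ) :
    A ∈ Bex p i j (s + 1) ↔ ∃ A0 ∈ Bex p i j s, A = p * A0 + (p - 1) := by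
  have key : ∀ k t : ℕ, (k + 1) * p ^ (t + 1) - 1 = p * ((k + 1) * p ^ t - 1) + (p - 1) := by
    intro k t
    have h1 : 1 ≤ (k + 1) * p ^ t := Nat.mul_pos (by omega) (Nat.pow_pos hp)
    have h2 : (k + 1) * p ^ (t + 1) = p * ((k + 1) * p ^ t) := by ring
    rw [h2]
    obtain ⟨q, hq⟩ : ∃ q, (k + 1) * p ^ t = q + 1 := ⟨_, (Nat.sub_add_cancel h1).symm⟩
    rw [hq, Nat.mul_add]
    simp
    omega
  constructor
  · rintro (⟨k, h1, h2, rfl⟩ | ⟨k, h1, rfl⟩)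
    · exact ⟨_, Or.inl ⟨k, h1, h2, rfl⟩, key k s⟩
    · exact ⟨_, Or.inr ⟨k, h1, rfl⟩, key k (s + 1)⟩
  · rintro ⟨A0, (⟨k, h1, h2, rfl⟩ | ⟨k, h1, rfl⟩), rfl⟩
    · exact Or.inl ⟨k, h1, h2, (key k s).symm⟩
    · exact Or.inr ⟨k, h1, (key k (s + 1)).symm⟩

lemma m_succ (p c s : ℕ) (hp : 2 ≤ p) (hc : p + 1 ≤ c) :
    c * p ^ (s + 1) - 2 = p * (c * p ^ s - 2) + (2 * p - 2) ∧ p - 1 ≤ c * p ^ s - 2 := by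
  have h1 : 1 ≤ p ^ s := Nat.pow_pos (by omega)
  have h2 : c * 1 ≤ c * p ^ s := Nat.mul_le_mul_left _ h1
  have h3 : c * p ^ (s + 1) = p * (c * p ^ s) := by ring
  constructor
  · rw [h3]
    obtain ⟨q, hq⟩ : ∃ q, c * p ^ s = q + 2 := ⟨c * p ^ s - 2, by omega⟩
    rw [hq, Nat.mul_add]
    simp
    omega
  · omega

lemma c_ge (p i j : ℕ) : p + 1 ≤ (i + 1) * p + j + 1 := by
  rw [add_mul, one_mul]; omega

lemma span_all (p : ℕ) [Fact p.Prime] (i j : ℕ) (hi : i ≤ p - 1) (hj : j ≤ p - 1) (s : ℕ) :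
    ∀ (w : ℕ → ZMod p), Kills p w (((i + 1) * p + j + 1) * p ^ s - 2) →
    (∀ A ∈ Bex p i j s, w A = 0) → ∀ A, A ≤ ((i + 1) * p + j + 1) * p ^ s - 2 → w A = 0 := by
  have hp : p.Prime := Fact.out
  have hp2 := hp.two_le
  induction s with
  | zero =>
    intro w hk hB
    rw [pow_zero, mul_one] at hk ⊢
    exact span_base p i j hi hj w hk hB
  | succ s ih =>
    intro w hk hB A hA
    obtain ⟨e, hM⟩ := m_succ p _ s hp2 (c_ge p i j)
    rw [e] at hk hA
    set M := ((i + 1) * p + j + 1) * p ^ s - 2 with hMdef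
    by_cases hmod : A % p = p - 1
    · have hz := ih (fun a => w (p * a + (p - 1))) ?_ ?_ (A / p) ?_
      · have := Nat.div_add_mod A p
        rw [hmod] at this
        simpa [this] using hz
      · intro k a b hk1 hm
        rw [← SS_kameko p (fun a => w (p * a + (p - 1))) w M k a b
          (fun A hA h => zero_off p w M hM hk A hA h) (fun _ => rfl) hm]
        apply hk
        · exact Nat.mul_pos (by omega) hk1
        · rw [← hm]
          have : p * (a + b + k * (p - 1)) = p * a + p * b + p * k * (p - 1) := by ring
          omega
      · intro a ha
        exact hB _ ((Bex_succ p i j s (by omega) _).mpr ⟨a, ha, rfl⟩)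
      · have := Nat.div_add_mod A p
        rw [hmod] at this
        by_contra hc
        have h2 : p * (M + 1) ≤ p * (A / p) := Nat.mul_le_mul_left _ (by omega)
        rw [Nat.mul_add] at h2
        omega
    · exact zero_off p w M hM hk A hA hmod

/-- The dual weight attached to the starting exponent `A0`. -/
noncomputable def wt (p j A0 : ℕ) : ℕ → ZMod p := fun A =>
  open Classical in
  if A0 ≤ A ∧ (p - 1) ∣ (A - A0) then
    ∏ l ∈ Finset.range ((A - A0) / (p - 1)),
      (((A0 : ZMod p) - (l : ZMod p) - (j : ZMod p)) * ((A0 : ZMod p) - (l : ZMod p))⁻¹)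
  else 0

lemma wt_chain (p j A0 u : ℕ) (hp : 2 ≤ p) : wt p j A0 (A0 + u * (p - 1)) =
    ∏ l ∈ Finset.range u,
      (((A0 : ZMod p) - (l : ZMod p) - (j : ZMod p)) * ((A0 : ZMod p) - (l : ZMod p))⁻¹) := by
  unfold wt
  rw [if_pos ⟨by omega, by simp⟩]
  rw [Nat.add_sub_cancel_left, Nat.mul_div_cancel _ (by omega)]

lemma wt_off (p j A0 A : ℕ) (h : ∀ u, A ≠ A0 + u * (p - 1)) : wt p j A0 A = 0 := by
  unfold wt
  rw [if_neg]
  rintro ⟨h1, u, h2⟩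
  apply h u
  rw [mul_comm u, ← h2]
  omega

lemma chain_mod (p A0 u : ℕ) (hp : 2 ≤ p) (hu : u ≤ A0 % p) :
    (A0 + u * (p - 1)) % p = A0 % p - u := by
  have hlt := Nat.mod_lt A0 (show p > 0 by omega)
  rw [mod_cast_eq _ _ _ (by omega), Nat.cast_sub hu, Nat.cast_add, Nat.cast_mul,
    cast_pm p (by omega), (mod_cast_eq p A0 (A0 % p) hlt).mp rfl]
  ring

lemma wt_zero_low (p : ℕ) [Fact p.Prime] (j A0 A : ℕ) (h0 : j ≤ A0 % p) (hA : A % p < j) :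
    wt p j A0 A = 0 := by
  have hp : p.Prime := Fact.out
  have hp2 := hp.two_le
  by_cases h : ∃ u, A = A0 + u * (p - 1)
  · obtain ⟨u, rfl⟩ := h
    rw [wt_chain p j A0 u hp2]
    have hlt := Nat.mod_lt A0 (show p > 0 by omega)
    have hu : A0 % p - j < u := by
      by_contra hc
      rw [chain_mod p A0 u hp2 (by omega)] at hA
      omega
    apply Finset.prod_eq_zero (Finset.mem_range.mpr hu)
    rw [Nat.cast_sub h0, (mod_cast_eq p A0 (A0 % p) hlt).mp rfl]
    ring
  · push Not at h
    exact wt_off p j A0 A h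

lemma Bex_zero_iff (p i j A : ℕ) :
    A ∈ Bex p i j 0 ↔ (min (i + 1) j ≤ A ∧ A ≤ p - 1) ∨ (∃ k, k ≤ i ∧ A = (k + 1) * p - 1) := by
  unfold Bex
  simp only [pow_zero, mul_one, zero_add, pow_one, Nat.add_sub_cancel, Set.mem_ofPred_eq]
  constructor
  · rintro (⟨k, h1, h2, rfl⟩ | h)
    · exact Or.inl ⟨h1, h2⟩
    · exact Or.inr h
  · rintro (⟨h1, h2⟩ | h)
    · exact Or.inl ⟨A, h1, h2, rfl⟩
    · exact Or.inr h

lemma top_mod (p k : ℕ) (hp : 2 ≤ p) : ((k + 1) * p - 1) % p = p - 1 := by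
  have : (k + 1) * p - 1 = p * k + (p - 1) := by rw [add_mul, mul_comm k]; omega
  rw [this, Nat.mul_add_mod, Nat.mod_eq_of_lt (by omega)]

/-- Digits of base-case basis exponents. -/
lemma Bex_zero_mod (p i j A : ℕ) (hp : 2 ≤ p) (h : A ∈ Bex p i j 0) :
    (A < p - 1 ∧ min (i + 1) j ≤ A) ∨ A % p = p - 1 := by
  rw [Bex_zero_iff] at h
  rcases h with ⟨h1, h2⟩ | ⟨k, _, rfl⟩
  · rcases Nat.lt_or_ge A (p - 1) with h3 | h3
    · exact Or.inl ⟨h3, h1⟩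
    · right
      rw [Nat.mod_eq_of_lt (by omega)]; omega
  · exact Or.inr (top_mod p k hp)

lemma wt_delta (p : ℕ) [Fact p.Prime] (i j A0 A1 : ℕ)
    (h1 : A1 ∈ Bex p i j 0) : wt p j A0 A1 = if A1 = A0 then 1 else 0 := by
  have hp : p.Prime := Fact.out
  have hp2 := hp.two_le
  by_cases h : ∃ u, A1 = A0 + u * (p - 1)
  · obtain ⟨u, rfl⟩ := h
    rw [wt_chain p j A0 u hp2]
    rcases Nat.eq_zero_or_pos u with rfl | hu
    · simp
    · have hge : 1 * (p - 1) ≤ u * (p - 1) := Nat.mul_le_mul_right _ hu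
      rw [if_neg (by omega)]
      have hmod : (A0 + u * (p - 1)) % p = p - 1 := by
        rcases Bex_zero_mod p i j _ hp2 h1 with h | h
        · omega
        · exact h
      have hlt := Nat.mod_lt A0 (show p > 0 by omega)
      have hlu : A0 % p < u := by
        by_contra hc
        rw [chain_mod p A0 u hp2 (by omega)] at hmod
        omega
      apply Finset.prod_eq_zero (Finset.mem_range.mpr hlu)
      rw [← (mod_cast_eq p A0 (A0 % p) hlt).mp rfl]
      simp
  · push Not at h
    rw [wt_off p j A0 A1 h, if_neg]
    intro he
    exact h 0 (by omega)

lemma wt_kills (p : ℕ) [Fact p.Prime] (i j A0 : ℕ) (hi : i ≤ p - 1) (hj : j ≤ p - 1)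
    (h0 : A0 ∈ Bex p i j 0) : Kills p (wt p j A0) ((i + 1) * p + j + 1 - 2) := by
  have hp : p.Prime := Fact.out
  have hp2 := hp.two_le
  have em : (i + 1) * p + j + 1 - 2 = p * i + j + (p - 1) := by
    rw [add_mul, one_mul, mul_comm i p]; omega
  rw [em]
  have hpi : p * i ≤ p * (p - 1) := Nat.mul_le_mul_left _ hi
  apply kills_of
  · intro A b hb
    have hbN : b = p * i + j - A := by omega
    have hbc : (b : ZMod p) = (j : ZMod p) - A := by
      rw [hbN, Nat.cast_sub (by omega)]
      push_cast; simp
    rw [hbc]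
    by_cases h : ∃ u, A = A0 + u * (p - 1)
    · obtain ⟨u, hu⟩ := h
      have hd : (A : ZMod p) = (A0 : ZMod p) - u := by
        rw [hu, Nat.cast_add, Nat.cast_mul, cast_pm p (by omega)]; ring
      have hstep : wt p j A0 (A + (p - 1)) =
          wt p j A0 A * (((A : ZMod p) - j) * (A : ZMod p)⁻¹) := by
        rw [hd]
        have : A + (p - 1) = A0 + (u + 1) * (p - 1) := by rw [hu]; ring
        rw [this, hu, wt_chain p j A0 _ hp2, wt_chain p j A0 _ hp2, Finset.prod_range_succ]
      rw [hstep]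
      by_cases hz : (A : ZMod p) = 0
      · rw [hz, zero_mul, zero_add, sub_zero]
        have hmod : A % p = 0 := by
          rw [mod_cast_eq p A 0 (by omega), hz]; simp
        rcases Nat.eq_zero_or_pos j with hj0 | hj0
        · rw [hj0]; simp
        · by_cases hlow : j ≤ A0 % p
          · rw [wt_zero_low p j A0 A hlow (by omega), mul_zero]
          · exfalso
            rcases Bex_zero_mod p i j _ hp2 h0 with ⟨h1, h2⟩ | h1
            · have hA0 : A0 % p = A0 := Nat.mod_eq_of_lt (by omega)
              have hku : A0 ≤ u := by
                by_contra hc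
                have := chain_mod p A0 u hp2 (by omega)
                rw [← hu, hmod] at this
                omega
              have hk2 : A0 * (p - 1) ≤ u * (p - 1) := Nat.mul_le_mul_right _ hku
              have hk3 : A0 + A0 * (p - 1) = p * A0 := by
                obtain ⟨q, rfl⟩ : ∃ q, p = q + 1 := ⟨p - 1, by omega⟩
                simp; ring
              have hk4 : p * (i + 1) ≤ p * A0 := Nat.mul_le_mul_left _ (by omega)
              rw [Nat.mul_add] at hk4
              omega
            · omega
      · field_simp
        ring
    · push Not at h
      rw [wt_off p j A0 A h, mul_zero, add_zero]
      by_cases h2 : ∃ u, A + (p - 1) = A0 + u * (p - 1)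
      · obtain ⟨u, hu⟩ := h2
        have hu0 : u = 0 := by
          by_contra hc
          obtain ⟨v, rfl⟩ : ∃ v, u = v + 1 := ⟨u - 1, by omega⟩
          apply h v
          rw [add_mul] at hu
          omega
        subst hu0
        rcases Bex_zero_mod p i j _ hp2 h0 with ⟨h1, h2⟩ | h1
        · omega
        · have hA0 : A0 = A + (p - 1) := by omega
          rw [mod_cast_eq p _ _ (by omega), hA0, Nat.cast_add] at h1
          have : (A : ZMod p) = 0 := by simpa using h1
          rw [this, zero_mul]
      · push Not at h2
        rw [wt_off p j A0 _ h2, mul_zero]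
  · intro k a b hk hdvd hm
    unfold SS
    apply Finset.sum_eq_zero
    rintro ⟨u, v⟩ huv
    rw [Finset.HasAntidiagonal.mem_antidiagonal] at huv
    simp only at huv ⊢
    rcases Nat.lt_or_ge a u with hu | hu
    · rw [Nat.choose_eq_zero_of_lt hu]; simp
    rcases Nat.lt_or_ge b v with hv | hv
    · rw [Nat.choose_eq_zero_of_lt hv]; simp
    obtain ⟨q, hq⟩ : ∃ q, p = q + 1 := ⟨p - 1, by omega⟩
    obtain ⟨t, ht⟩ := hdvd
    have ht1 : t = 1 := by
      have : t ≠ 0 := by rintro rfl; omega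
      by_contra hc
      have h2 : p * 2 ≤ p * t := Nat.mul_le_mul_left _ (by omega)
      have h3 : (p * 2) * (p - 1) ≤ k * (p - 1) := Nat.mul_le_mul_right _ (by omega)
      have h4 : p * 2 * (p - 1) = p * (p - 1) + p * (p - 1) := by ring
      omega
    subst ht1
    rw [mul_one] at ht
    subst ht
    have hii : i = k - 1 := by
      by_contra hc
      have h2 : k * (i + 1) ≤ k * (k - 1) := Nat.mul_le_mul_left _ (by omega)
      rw [Nat.mul_add] at h2
      omega
    have hab : a + b = k + j - 1 := by
      have e : k * i = k * (k - 1) := by rw [hii]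
      omega
    rw [wt_zero_low k j A0, mul_zero]
    · rcases Bex_zero_mod k i j _ hp2 h0 with ⟨h1, h2⟩ | h1
      · rw [Nat.mod_eq_of_lt (by omega)]; omega
      · omega
    · have : a + u * (k - 1) = k * u + (a - u) := by
        have : k * u = u * (k - 1) + u := by rw [hq]; simp; ring
        omega
      rw [this, Nat.mul_add_mod, Nat.mod_eq_of_lt (by omega)]
      omega

lemma choose_digit (p : ℕ) [Fact p.Prime] (a u : ℕ) (h : (Nat.choose a u : ZMod p) ≠ 0)
    (hm : (a + u * (p - 1)) % p = p - 1) : a % p = p - 1 ∧ u % p = 0 := by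
  have hp : p.Prime := Fact.out
  have hp2 := hp.two_le
  have hle : u % p ≤ a % p := by
    by_contra hc
    apply h
    have := Choose.choose_modEq_choose_mod_mul_choose_div_nat (n := a) (k := u) (p := p)
    rw [← ZMod.natCast_eq_natCast_iff] at this
    rw [this, Nat.choose_eq_zero_of_lt (by omega)]
    simp
  have e : (a + u * (p - 1)) % p = (a + (u % p) * (p - 1)) % p := by
    simp [Nat.add_mod, Nat.mul_mod]
  rw [e, chain_mod p a _ hp2 hle] at hm
  have hlt := Nat.mod_lt a (show p > 0 by omega)
  omega

lemma kills_lift (p : ℕ) [Fact p.Prime] (w : ℕ → ZMod p) (m : ℕ) (hk : Kills p w m) :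
    Kills p (fun A => if A % p = p - 1 then w (A / p) else 0) (p * m + (2 * p - 2)) := by
  have hp : p.Prime := Fact.out
  have hp2 := hp.two_le
  intro k a b hk1 hm
  by_cases hc : a % p = p - 1 ∧ b % p = p - 1 ∧ k % p = 0
  · obtain ⟨ha, hb, hkp⟩ := hc
    have ea := Nat.div_add_mod a p
    have eb := Nat.div_add_mod b p
    have ek := Nat.div_add_mod k p
    rw [ha] at ea
    rw [hb] at eb
    rw [hkp, add_zero] at ek
    have hdeg : a / p + b / p + k / p * (p - 1) = m := by
      apply Nat.eq_of_mul_eq_mul_left (show 0 < p by omega)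
      have : p * (a / p + b / p + k / p * (p - 1)) =
        p * (a / p) + p * (b / p) + (p * (k / p)) * (p - 1) := by ring
      rw [this, ek]
      omega
    have h := SS_kameko p w (fun A => if A % p = p - 1 then w (A / p) else 0) m (k / p) (a / p)
      (b / p) (fun A _ h => if_neg h) ?_ hdeg
    · rw [ea, eb, ek] at h
      rw [h]
      apply hk _ _ _ _ hdeg
      by_contra hc
      have : k / p = 0 := Nat.eq_zero_of_not_pos hc
      rw [this] at ek
      omega
    · intro A
      have e1 : (p * A + (p - 1)) % p = p - 1 := by
        rw [Nat.mul_add_mod, Nat.mod_eq_of_lt (by omega)]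
      have e2 : (p * A + (p - 1)) / p = A := by
        rw [Nat.mul_add_div (by omega), Nat.div_eq_of_lt (by omega), add_zero]
      simp only [e1, e2, if_true]
  · unfold SS
    apply Finset.sum_eq_zero
    rintro ⟨u, v⟩ huv
    rw [Finset.HasAntidiagonal.mem_antidiagonal] at huv
    simp only at huv ⊢
    by_contra hne
    have h1 := left_ne_zero_of_mul hne
    have hw := right_ne_zero_of_mul hne
    have hca := left_ne_zero_of_mul h1
    have hcb := right_ne_zero_of_mul h1
    have hA : (a + u * (p - 1)) % p = p - 1 := by
      by_contra hh
      exact hw (if_neg hh)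
    have hB : (b + v * (p - 1)) % p = p - 1 := by
      rw [mod_cast_eq p _ _ (by omega), cast_pm p (by omega)] at hA ⊢
      have hs : (a + u * (p - 1)) + (b + v * (p - 1)) = p * m + (2 * p - 2) := by
        rw [← hm, ← huv]; ring
      have hs2 := congrArg (Nat.cast : ℕ → ZMod p) hs
      rw [Nat.cast_add, hA, Nat.cast_add (p * m), Nat.cast_sub (by omega)] at hs2
      push_cast at hs2 ⊢
      simp at hs2
      linear_combination hs2
    obtain ⟨a1, a2⟩ := choose_digit p a u hca hA
    obtain ⟨b1, b2⟩ := choose_digit p b v hcb hB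
    apply hc
    refine ⟨a1, b1, ?_⟩
    rw [← huv, Nat.add_mod, a2, b2]
    simp

lemma indep_all (p : ℕ) [Fact p.Prime] (i j : ℕ) (hi : i ≤ p - 1) (hj : j ≤ p - 1) (s : ℕ) :
    ∀ A0 ∈ Bex p i j s, ∃ w : ℕ → ZMod p, Kills p w (((i + 1) * p + j + 1) * p ^ s - 2) ∧
      ∀ A1 ∈ Bex p i j s, w A1 = if A1 = A0 then 1 else 0 := by
  have hp : p.Prime := Fact.out
  have hp2 := hp.two_le
  induction s with
  | zero =>
    intro A0 h0
    rw [pow_zero, mul_one]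
    exact ⟨wt p j A0, wt_kills p i j A0 hi hj h0, fun A1 h1 => wt_delta p i j A0 A1 h1⟩
  | succ s ih =>
    intro A0 h0
    rw [Bex_succ p i j s (by omega)] at h0
    obtain ⟨B0, hB0, rfl⟩ := h0
    obtain ⟨w, hw, hd⟩ := ih B0 hB0
    rw [(m_succ p _ s hp2 (c_ge p i j)).1]
    refine ⟨_, kills_lift p w _ hw, ?_⟩
    intro A1 h1
    rw [Bex_succ p i j s (by omega)] at h1
    obtain ⟨B1, hB1, rfl⟩ := h1
    have e1 : (p * B1 + (p - 1)) % p = p - 1 := by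
      rw [Nat.mul_add_mod, Nat.mod_eq_of_lt (by omega)]
    have e2 : (p * B1 + (p - 1)) / p = B1 := by
      rw [Nat.mul_add_div (by omega), Nat.div_eq_of_lt (by omega), add_zero]
    simp only [e1, e2, if_true]
    rw [hd B1 hB1]
    by_cases hBB : B1 = B0
    · simp [hBB]
    · rw [if_neg hBB, if_neg]
      intro h
      apply hBB
      apply Nat.eq_of_mul_eq_mul_left (show 0 < p by omega)
      omega

lemma coeff_lin_pow {R : Type*} [CommRing R] (r t : R) (a u : ℕ) :
    ((Polynomial.C r + Polynomial.C t * Polynomial.X) ^ a).coeff u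
      = (Nat.choose a u : R) * (r ^ (a - u) * t ^ u) := by
  rw [add_comm, add_pow, Polynomial.finsetSum_coeff]
  have : ∀ n ∈ Finset.range (a + 1),
      ((Polynomial.C t * Polynomial.X) ^ n * Polynomial.C r ^ (a - n) *
        ((Nat.choose a n : ℕ) : Polynomial R)).coeff u
      = if n = u then (Nat.choose a u : R) * (r ^ (a - u) * t ^ u) else 0 := by
    intro n _
    have e : (Polynomial.C t * Polynomial.X) ^ n * Polynomial.C r ^ (a - n) *
        ((Nat.choose a n : ℕ) : Polynomial R) =
        Polynomial.C ((Nat.choose a n : R) * (r ^ (a - n) * t ^ n)) * Polynomial.X ^ n := by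
      simp only [map_mul, map_pow, map_natCast]
      ring
    rw [e, Polynomial.coeff_C_mul_X_pow]
    by_cases h : n = u
    · subst h; simp
    · rw [if_neg h, if_neg (fun h' => h h'.symm)]
  rw [Finset.sum_congr rfl this, Finset.sum_ite_eq']
  split_ifs with h
  · rfl
  · rw [Finset.mem_range] at h
    rw [Nat.choose_eq_zero_of_lt (by omega)]
    simp

/-- The monomial `x^a y^b`. -/
noncomputable def EE (p a b : ℕ) : MvPolynomial (Fin 2) (ZMod p) := X 0 ^ a * X 1 ^ b

lemma steenrod_EE (p : ℕ) (hp : 1 ≤ p) (k a b : ℕ) :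
    steenrodP p 2 k (EE p a b) = ∑ q ∈ Finset.HasAntidiagonal.antidiagonal k,
      ((Nat.choose a q.1 : ZMod p) * (Nat.choose b q.2 : ZMod p)) •
        EE p (a + q.1 * (p - 1)) (b + q.2 * (p - 1)) := by
  have pw : ∀ (z : MvPolynomial (Fin 2) (ZMod p)) (c u : ℕ),
      (Nat.choose c u : MvPolynomial (Fin 2) (ZMod p)) * (z ^ (c - u) * (z ^ p) ^ u)
        = (Nat.choose c u : MvPolynomial (Fin 2) (ZMod p)) * z ^ (c + u * (p - 1)) := by
    intro z c u
    rcases le_or_gt u c with h | h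
    · rw [← pow_mul, ← pow_add]
      congr 2
      obtain ⟨q, rfl⟩ : ∃ q, p = q + 1 := ⟨p - 1, by omega⟩
      simp only [Nat.add_sub_cancel]
      have : (q + 1) * u = u * q + u := by ring
      omega
    · rw [Nat.choose_eq_zero_of_lt h]; simp
  unfold steenrodP Phi EE
  rw [map_mul, map_pow, map_pow, aeval_X, aeval_X, Polynomial.coeff_mul]
  apply Finset.sum_congr rfl
  intro q _
  rw [coeff_lin_pow, coeff_lin_pow, pw, pw, MvPolynomial.smul_eq_C_mul]
  simp only [map_mul, map_natCast]
  ring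

/-- `𝒫^k` as a linear map. -/
noncomputable def SPlin (p k : ℕ) :
    MvPolynomial (Fin 2) (ZMod p) →ₗ[ZMod p] MvPolynomial (Fin 2) (ZMod p) where
  toFun := steenrodP p 2 k
  map_add' := by intro f g; simp [steenrodP]
  map_smul' := by intro c f; simp [steenrodP]

lemma monomial_EE (p : ℕ) (d : Fin 2 →₀ ℕ) (c : ZMod p) :
    monomial d c = c • EE p (d 0) (d 1) := by
  rw [EE, MvPolynomial.monomial_eq, MvPolynomial.smul_eq_C_mul]
  congr 1
  rw [Finsupp.prod_fintype _ _ (by simp)]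
  simp

lemma EE_span (p : ℕ) (f : MvPolynomial (Fin 2) (ZMod p)) :
    f ∈ Submodule.span (ZMod p) (Set.range (fun q : ℕ × ℕ => EE p q.1 q.2)) := by
  induction f using MvPolynomial.induction_on' with
  | monomial d c =>
    rw [monomial_EE]
    exact Submodule.smul_mem _ _ (Submodule.subset_span ⟨(d 0, d 1), rfl⟩)
  | add f g hf hg => exact Submodule.add_mem _ hf hg

lemma hit_le (p : ℕ) (W : Submodule (ZMod p) (MvPolynomial (Fin 2) (ZMod p)))
    (h : ∀ k a b, 1 ≤ k → steenrodP p 2 k (EE p a b) ∈ W) : Hit p 2 ≤ W := by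
  unfold Hit
  rw [Submodule.span_le]
  rintro g ⟨k, hk, u, rfl⟩
  have hle : Submodule.span (ZMod p) (Set.range (fun q : ℕ × ℕ => EE p q.1 q.2)) ≤
      W.comap (SPlin p k) := by
    rw [Submodule.span_le]
    rintro _ ⟨q, rfl⟩
    exact h k q.1 q.2 hk
  exact hle (EE_span p u)

/-- Functional attached to a weight. -/
noncomputable def ell (p m : ℕ) (w : ℕ → ZMod p) :
    MvPolynomial (Fin 2) (ZMod p) →ₗ[ZMod p] ZMod p :=
  (MvPolynomial.basisMonomials (Fin 2) (ZMod p)).constr (ZMod p)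
    (fun d => if d 0 + d 1 = m then w (d 0) else 0)

lemma ell_EE (p m : ℕ) (w : ℕ → ZMod p) (a b : ℕ) :
    ell p m w (EE p a b) = if a + b = m then w a else 0 := by
  have h : EE p a b = MvPolynomial.basisMonomials (Fin 2) (ZMod p)
      (Finsupp.single 0 a + Finsupp.single 1 b) := by
    simp only [MvPolynomial.coe_basisMonomials, monomial_EE]
    simp
  rw [h, ell, Module.Basis.constr_basis]
  simp

lemma ell_hit (p m : ℕ) (hp : 1 ≤ p) (w : ℕ → ZMod p) (hw : Kills p w m) :
    Hit p 2 ≤ LinearMap.ker (ell p m w) := by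
  apply hit_le
  intro k a b hk
  rw [LinearMap.mem_ker, steenrod_EE p hp, map_sum]
  simp only [map_smul, ell_EE, smul_eq_mul]
  have hd : ∀ q ∈ Finset.HasAntidiagonal.antidiagonal k,
      a + q.1 * (p - 1) + (b + q.2 * (p - 1)) = a + b + k * (p - 1) := by
    intro q hq
    rw [Finset.HasAntidiagonal.mem_antidiagonal] at hq
    rw [← hq]; ring
  by_cases hm : a + b + k * (p - 1) = m
  · rw [← hw k a b hk hm, SS]
    apply Finset.sum_congr rfl
    intro q hq
    rw [if_pos (by rw [hd q hq, hm])]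
  · apply Finset.sum_eq_zero
    intro q hq
    rw [if_neg (by rw [hd q hq]; exact hm), mul_zero]

lemma kills_of_hit (p m : ℕ) (hp : 1 ≤ p)
    (l : MvPolynomial (Fin 2) (ZMod p) →ₗ[ZMod p] ZMod p) (hl : Hit p 2 ≤ LinearMap.ker l) :
    Kills p (fun A => l (EE p A (m - A))) m := by
  intro k a b hk hm
  have h : l (steenrodP p 2 k (EE p a b)) = 0 :=
    hl (Submodule.subset_span ⟨k, hk, _, rfl⟩)
  rw [steenrod_EE p hp, map_sum] at h
  rw [← h, SS]
  apply Finset.sum_congr rfl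
  intro q hq
  rw [Finset.HasAntidiagonal.mem_antidiagonal] at hq
  rw [map_smul, smul_eq_mul]
  congr 3
  have : a + b + k * (p - 1) = (a + q.1 * (p - 1)) + (b + q.2 * (p - 1)) := by rw [← hq]; ring
  omega

lemma basisSet9_eq (p i j s m : ℕ) :
    basisSet9 p i j s m = (fun A => EE p A (m - A)) '' Bex p i j s := by
  ext g
  constructor
  · rintro (⟨k, h1, h2, rfl⟩ | ⟨k, h1, rfl⟩)
    · exact ⟨_, Or.inl ⟨k, h1, h2, rfl⟩, rfl⟩
    · exact ⟨_, Or.inr ⟨k, h1, rfl⟩, rfl⟩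
  · rintro ⟨A, (⟨k, h1, h2, rfl⟩ | ⟨k, h1, rfl⟩), rfl⟩
    · exact Or.inl ⟨k, h1, h2, rfl⟩
    · exact Or.inr ⟨k, h1, rfl⟩

lemma Bex_le (p i j s : ℕ) (hp : 2 ≤ p) :
    ∀ A ∈ Bex p i j s, A ≤ ((i + 1) * p + j + 1) * p ^ s - 2 := by
  have hps : 1 ≤ p ^ s := Nat.pow_pos (by omega)
  have e : ((i + 1) * p + j + 1) * p ^ s = (i + 1) * p * p ^ s + j * p ^ s + p ^ s := by ring
  have key : ∀ c, c ≤ (i + 1) * p → c * p ^ s - 1 ≤ ((i + 1) * p + j + 1) * p ^ s - 2 := by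
    intro c hc
    have := Nat.mul_le_mul_right (p ^ s) hc
    omega
  rintro A (⟨k, h1, h2, rfl⟩ | ⟨k, h1, rfl⟩)
  · apply key
    rw [add_mul]
    omega
  · have e2 : (k + 1) * p ^ (s + 1) = (k + 1) * p * p ^ s := by ring
    rw [e2]
    apply key
    exact Nat.mul_le_mul_right _ (by omega)

/-- Crossley's Theorem 1.1, second case: for `m = ((i+1)p + j + 1)p^s - 2` with
`0 ≤ i, j ≤ p-1`, `s ≥ 0`, the monomials of `basisSet9` lie in the degree-`m` homogeneous
part `V_m` and their images form a basis of `V_m/(V_m ∩ H)`: the images mod the hit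
polynomials `H` are linearly independent, and every homogeneous polynomial of degree `m`
lies in `H ⊔ span(basisSet9)`. -/
theorem crossley_case2 (p : ℕ) (hp : p.Prime) (hodd : Odd p) (i j s m : ℕ)
    (hi : i ≤ p - 1) (hj : j ≤ p - 1) (hm : m = ((i + 1) * p + j + 1) * p ^ s - 2) :
    (∀ g ∈ basisSet9 p i j s m, g.IsHomogeneous m) ∧
    LinearIndependent (ZMod p)
      (fun g : basisSet9 p i j s m =>
        Submodule.Quotient.mk (p := Hit p 2) (g : MvPolynomial (Fin 2) (ZMod p))) ∧
    (∀ f : MvPolynomial (Fin 2) (ZMod p), f.IsHomogeneous m →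
        f ∈ Hit p 2 ⊔ Submodule.span (ZMod p) (basisSet9 p i j s m)) := by
  have : Fact p.Prime := ⟨hp⟩
  have hp2 := hp.two_le
  have hle := Bex_le p i j s hp2
  rw [← hm] at hle
  refine ⟨?_, ?_, ?_⟩
  · rw [basisSet9_eq]
    rintro g ⟨A, hA, rfl⟩
    have h := ((MvPolynomial.isHomogeneous_X (ZMod p) (0 : Fin 2)).pow A).mul
      ((MvPolynomial.isHomogeneous_X (ZMod p) (1 : Fin 2)).pow (m - A))
    have e : 1 * A + 1 * (m - A) = m := by
      have := hle A hA
      omega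
    rw [e] at h
    exact h
  · rw [linearIndependent_iff']
    intro S c hsum g hg
    have hg9 := (Set.ext_iff.mp (basisSet9_eq p i j s m) _).mp g.2
    obtain ⟨A0, hA0, hgA⟩ := hg9
    obtain ⟨w, hw, hd⟩ := indep_all p i j hi hj s A0 hA0
    rw [← hm] at hw
    have hsum2 := congrArg ((Hit p 2).liftQ (ell p m w) (ell_hit p m (by omega) w hw)) hsum
    rw [map_sum, map_zero] at hsum2
    simp only [map_smul, smul_eq_mul] at hsum2
    have hval : ∀ x : basisSet9 p i j s m, ((Hit p 2).liftQ (ell p m w)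
        (ell_hit p m (by omega) w hw)) (Submodule.Quotient.mk (x : MvPolynomial (Fin 2) (ZMod p)))
        = if x = g then 1 else 0 := by
      intro x
      have hx9 := (Set.ext_iff.mp (basisSet9_eq p i j s m) _).mp x.2
      obtain ⟨A1, hA1, hxA⟩ := hx9
      have h1 : ((Hit p 2).liftQ (ell p m w) (ell_hit p m (by omega) w hw))
        (Submodule.Quotient.mk (x : MvPolynomial (Fin 2) (ZMod p))) = ell p m w x := rfl
      have hl1 := hle A1 hA1
      rw [h1, ← hxA]
      simp only
      rw [ell_EE, if_pos (by omega), hd A1 hA1]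
      by_cases hAA : A1 = A0
      · have : x = g := by
          apply Subtype.ext
          rw [← hxA, ← hgA, hAA]
        rw [if_pos hAA, if_pos this]
      · rw [if_neg hAA, if_neg]
        intro hxg
        have h3 : w A1 = w A0 := by
          have h4 : EE p A1 (m - A1) = EE p A0 (m - A0) := by
            rw [hxg] at hxA
            exact hxA.trans hgA.symm
          have h5 := congrArg (ell p m w) h4
          have hl0 := hle A0 hA0
          rwa [ell_EE, ell_EE, if_pos (by omega), if_pos (by omega)] at h5
        rw [hd A1 hA1, hd A0 hA0, if_neg hAA, if_pos rfl] at h3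
        exact zero_ne_one h3
    simp only [hval] at hsum2
    simpa [hg] using hsum2
  · intro f hf
    by_contra hnot
    obtain ⟨l, hl1, hl2⟩ := Submodule.exists_le_ker_of_notMem hnot
    have hz := span_all p i j hi hj s (fun A => l (EE p A (m - A)))
      (by
        rw [← hm]
        exact kills_of_hit p m (by omega) l (le_sup_left.trans hl2))
      (by
        intro A hA
        have : EE p A (m - A) ∈ LinearMap.ker l := by
          apply hl2
          apply Submodule.mem_sup_right
          apply Submodule.subset_span
          rw [basisSet9_eq]
          exact ⟨A, hA, rfl⟩
        exact this)
    rw [← hm] at hz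
    apply hl1
    rw [f.as_sum, map_sum]
    apply Finset.sum_eq_zero
    intro d hd
    have hdeg := hf (MvPolynomial.mem_support_iff.mp hd)
    rw [Finsupp.weight_apply, Finsupp.sum_fintype _ _ (by simp)] at hdeg
    simp at hdeg
    rw [monomial_EE, map_smul]
    have h6 := hz (d 0) (by omega)
    rw [show m - d 0 = d 1 by omega] at h6
    rw [h6, smul_zero]
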